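/- Let k ≥ 1 and n1, ..., nk be integers with ni ≥ 2 for all i ∈ [k] and ni = 2 for at least one i ∈ [k]. Then for every n, sat*(n, K_{n1,...,nk}) ≥ sat*(n, D2), where D2 is the diamond poset (the poset with a least element, a greatest element, and two incomparable middle elements, i.e. K_{1,2,1}). -/

import Mathlib

open Finset Filter

/-- An induced copy of the poset `α` inside the family `𝒜` of subsets of `Fin n`
(representing `[n] = {1,…,n}`): an injective map `f : α → Finset (Fin n)` with image
contained in `𝒜` such that `a ≤ b ↔ f a ⊆ f b`. -/
def IsInducedCopy {α : Type*} [PartialOrder α] {n : ℕ}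
    (𝒜 : Finset (Finset (Fin n))) (f : α → Finset (Fin n)) : Prop :=
  Function.Injective f ∧ (∀ a, f a ∈ 𝒜) ∧ ∀ a b : α, a ≤ b ↔ f a ⊆ f b

/-- The family `𝒜` contains an induced copy of the poset `α`. -/
def ContainsCopy (α : Type*) [PartialOrder α] {n : ℕ}
    (𝒜 : Finset (Finset (Fin n))) : Prop :=
  ∃ f : α → Finset (Fin n), IsInducedCopy 𝒜 f

/-- `𝒜` is an `α`-saturated family: it contains no induced copy of `α`, but adding any
set not in `𝒜` creates an induced copy of `α`. -/
def IsSaturatedFamily (α : Type*) [PartialOrder α] {n : ℕ}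
    (𝒜 : Finset (Finset (Fin n))) : Prop :=
  ¬ ContainsCopy α 𝒜 ∧
    ∀ S : Finset (Fin n), S ∉ 𝒜 → ContainsCopy α (insert S 𝒜)

/-- The induced saturation number `sat*(n, α)`: the minimum size of an `α`-saturated
family of subsets of `[n]`. -/
noncomputable def satStar (α : Type*) [PartialOrder α] (n : ℕ) : ℕ :=
  sInf {k : ℕ | ∃ 𝒜 : Finset (Finset (Fin n)), IsSaturatedFamily α 𝒜 ∧ 𝒜.card = k}

/-- The complete `k`-layered poset `K_{ns 0, …, ns (k-1)}`: layer `i` is an antichain of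
size `ns i`, and every element of a lower layer is below every element of a higher
layer. -/
def KPoset {k : ℕ} (ns : Fin k → ℕ) : Type := Σ i : Fin k, Fin (ns i)

instance {k : ℕ} (ns : Fin k → ℕ) : PartialOrder (KPoset ns) where
  le x y := x = y ∨ x.1 < y.1
  le_refl x := Or.inl rfl
  le_trans x y z hxy hyz := by
    rcases hxy with rfl | h
    · exact hyz
    · rcases hyz with rfl | h2
      · exact Or.inr h
      · exact Or.inr (h.trans h2)
  le_antisymm x y hxy hyx := by
    rcases hxy with rfl | h
    · rfl
    · rcases hyx with rfl | h2
      · rfl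
      · exact absurd (h.trans h2) (lt_irrefl _)

/-- An order-reflecting map into the family is an induced copy; injectivity is automatic. -/
theorem isInducedCopy_of_le_iff {α : Type*} [PartialOrder α] {n : ℕ}
    {𝒜 : Finset (Finset (Fin n))} {f : α → Finset (Fin n)} (hmem : ∀ a, f a ∈ 𝒜)
    (hle : ∀ a b : α, a ≤ b ↔ f a ⊆ f b) : IsInducedCopy 𝒜 f :=
  ⟨fun a b h => le_antisymm ((hle a b).2 h.subset) ((hle b a).2 h.symm.subset), hmem, hle⟩

theorem IsInducedCopy.of_mem {α : Type*} [PartialOrder α] {n : ℕ}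
    {𝒜 ℬ : Finset (Finset (Fin n))} {f : α → Finset (Fin n)} (hf : IsInducedCopy 𝒜 f)
    (hmem : ∀ a, f a ∈ ℬ) : IsInducedCopy ℬ f :=
  ⟨hf.1, hmem, hf.2.2⟩

theorem isInducedCopy_const {α : Type*} [PartialOrder α] [Subsingleton α] {n : ℕ}
    {𝒜 : Finset (Finset (Fin n))} {X : Finset (Fin n)} (hX : X ∈ 𝒜) :
    IsInducedCopy 𝒜 (fun _ : α => X) :=
  isInducedCopy_of_le_iff (fun _ => hX) fun a b => by simp [Subsingleton.elim a b]

theorem ContainsCopy.congr {α β : Type*} [PartialOrder α] [PartialOrder β] (e : α ≃o β) {n : ℕ}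
    {𝒜 : Finset (Finset (Fin n))} (h : ContainsCopy α 𝒜) : ContainsCopy β 𝒜 := by
  obtain ⟨f, hf⟩ := h
  exact ⟨f ∘ e.symm, isInducedCopy_of_le_iff (fun b => hf.2.1 _) fun a b => by
    rw [← e.symm.le_iff_le, hf.2.2]; rfl⟩

theorem IsSaturatedFamily.congr {α β : Type*} [PartialOrder α] [PartialOrder β] (e : α ≃o β)
    {n : ℕ} {𝒜 : Finset (Finset (Fin n))} (h : IsSaturatedFamily α 𝒜) :
    IsSaturatedFamily β 𝒜 :=
  ⟨fun hc => h.1 (hc.congr e.symm), fun S hS => (h.2 S hS).congr e⟩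

theorem ContainsCopy.dual_compl {α : Type*} [PartialOrder α] {n : ℕ}
    {𝒜 : Finset (Finset (Fin n))} (h : ContainsCopy α 𝒜) :
    ContainsCopy αᵒᵈ (𝒜.image compl) := by
  obtain ⟨f, hf⟩ := h
  refine ⟨fun a => (f (OrderDual.ofDual a))ᶜ, isInducedCopy_of_le_iff
    (fun a => mem_image_of_mem _ (hf.2.1 _)) fun a b => ?_⟩
  rw [← OrderDual.ofDual_le_ofDual, hf.2.2, Finset.compl_subset_compl]

theorem image_compl_image_compl {n : ℕ} (𝒜 : Finset (Finset (Fin n))) :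
    (𝒜.image compl).image compl = 𝒜 := by
  ext X; simp

theorem IsSaturatedFamily.dual_compl {α : Type*} [PartialOrder α] {n : ℕ}
    {𝒜 : Finset (Finset (Fin n))} (h : IsSaturatedFamily α 𝒜) :
    IsSaturatedFamily αᵒᵈ (𝒜.image compl) := by
  refine ⟨fun hc => h.1 ?_, fun S hS => ?_⟩
  · have := hc.dual_compl
    rw [image_compl_image_compl] at this
    exact this.congr (OrderIso.dualDual α).symm
  · have hS' : Sᶜ ∉ 𝒜 := fun hc => hS (mem_image.2 ⟨Sᶜ, hc, compl_compl S⟩)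
    have := (h.2 _ hS').dual_compl
    rwa [image_insert, compl_compl] at this

/-- A copy of an ordinal sum is a copy of the lower part lying below a copy of the upper part. -/
theorem containsCopy_sumLex_iff {M B : Type*} [PartialOrder M] [PartialOrder B] {n : ℕ}
    {𝒜 : Finset (Finset (Fin n))} :
    ContainsCopy (M ⊕ₗ B) 𝒜 ↔ ∃ (p : M → Finset (Fin n)) (q : B → Finset (Fin n)),
      IsInducedCopy 𝒜 p ∧ IsInducedCopy 𝒜 q ∧ ∀ m b, p m ⊂ q b := by
  constructor
  · rintro ⟨f, hf⟩
    refine ⟨fun m => f (Sum.inlₗ m), fun b => f (Sum.inrₗ b),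
      isInducedCopy_of_le_iff (fun _ => hf.2.1 _) fun a b => ?_,
      isInducedCopy_of_le_iff (fun _ => hf.2.1 _) fun a b => ?_, fun m b => ⟨?_, ?_⟩⟩
    · rw [← hf.2.2, Sum.Lex.inl_le_inl_iff]
    · rw [← hf.2.2, Sum.Lex.inr_le_inr_iff]
    · exact (hf.2.2 _ _).1 (Sum.Lex.inl_le_inr _ _)
    · exact fun h => Sum.Lex.not_inr_le_inl ((hf.2.2 _ _).2 h)
  · rintro ⟨p, q, hp, hq, hpq⟩
    refine ⟨fun x => Sum.elim p q (ofLex x), isInducedCopy_of_le_iff ?_ ?_⟩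
    · rintro (m | b)
      · exact hp.2.1 m
      · exact hq.2.1 b
    · rintro (m | b) (m' | b')
      · exact Sum.Lex.inl_le_inl_iff.trans (hp.2.2 _ _)
      · exact iff_of_true (Sum.Lex.inl_le_inr _ _) (hpq _ _).1
      · exact iff_of_false Sum.Lex.not_inr_le_inl (hpq _ _).2
      · exact Sum.Lex.inr_le_inr_iff.trans (hq.2.2 _ _)

/-- The family `𝒜` contains a copy of `M` strictly below the set `X`. -/
def HasCopyBelow (M : Type*) [PartialOrder M] {n : ℕ} (𝒜 : Finset (Finset (Fin n)))
    (X : Finset (Fin n)) : Prop :=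
  ∃ p : M → Finset (Fin n), IsInducedCopy 𝒜 p ∧ ∀ m, p m ⊂ X

/-- The family `𝒜` contains a copy of `B` all of whose members contain `X`. -/
def HasCopyAbove (B : Type*) [PartialOrder B] {n : ℕ} (𝒜 : Finset (Finset (Fin n)))
    (X : Finset (Fin n)) : Prop :=
  ∃ q : B → Finset (Fin n), IsInducedCopy 𝒜 q ∧ ∀ b, X ⊆ q b

theorem HasCopyBelow.mono {M : Type*} [PartialOrder M] {n : ℕ} {𝒜 : Finset (Finset (Fin n))}
    {X Y : Finset (Fin n)} (h : HasCopyBelow M 𝒜 X) (hXY : X ⊆ Y) : HasCopyBelow M 𝒜 Y := by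
  obtain ⟨p, hp, hlt⟩ := h
  exact ⟨p, hp, fun m => (hlt m).trans_subset hXY⟩

theorem containsCopy_sumLex_of_below_above {M B : Type*} [PartialOrder M] [PartialOrder B]
    {n : ℕ} {𝒜 : Finset (Finset (Fin n))} {X : Finset (Fin n)} (hM : HasCopyBelow M 𝒜 X)
    (hB : HasCopyAbove B 𝒜 X) : ContainsCopy (M ⊕ₗ B) 𝒜 := by
  obtain ⟨p, hp, hlt⟩ := hM
  obtain ⟨q, hq, hle⟩ := hB
  exact containsCopy_sumLex_iff.2 ⟨p, q, hp, hq, fun m b => (hlt m).trans_subset (hle b)⟩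

/-- Copies below `X` can be found among the sets that have no copy below themselves. -/
theorem HasCopyBelow.filter {M : Type*} [PartialOrder M] {n : ℕ} {𝒜 𝒢 : Finset (Finset (Fin n))}
    (h𝒢 : ∀ X, X ∈ 𝒢 ↔ X ∈ 𝒜 ∧ ¬ HasCopyBelow M 𝒜 X) (X : Finset (Fin n))
    (h : HasCopyBelow M 𝒜 X) : HasCopyBelow M 𝒢 X := by
  induction X using Finset.strongInduction with
  | H X ih =>
    obtain ⟨p, hp, hlt⟩ := h
    by_cases hall : ∀ m, p m ∈ 𝒢
    · exact ⟨p, hp.of_mem hall, hlt⟩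
    · push Not at hall
      obtain ⟨m, hm⟩ := hall
      rw [h𝒢, not_and_not_right] at hm
      exact (ih _ (hlt m) (hm (hp.2.1 m))).mono (hlt m).1

/-- In a saturated family for an ordinal sum `M ⊕ₗ B`, with `M` having no greatest element, a set
that is maximal among those lying below a copy of `B` belongs to the family. -/
theorem IsSaturatedFamily.mem_of_maximal {M B : Type*} [PartialOrder M] [PartialOrder B] {n : ℕ}
    {𝒜 : Finset (Finset (Fin n))} (h : IsSaturatedFamily (M ⊕ₗ B) 𝒜)
    (hM : ∀ m : M, ∃ m', ¬ m' ≤ m) {Z : Finset (Fin n)} (hZ : Maximal (HasCopyAbove B 𝒜) Z) :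
    Z ∈ 𝒜 := by
  by_contra hZ𝒜
  obtain ⟨p, q, hp, hq, hpq⟩ := containsCopy_sumLex_iff.1 (h.2 Z hZ𝒜)
  by_cases hqZ : ∃ b, q b = Z
  · obtain ⟨b, rfl⟩ := hqZ
    exact h.1 (containsCopy_sumLex_of_below_above ⟨p, hp.of_mem fun m =>
      mem_of_mem_insert_of_ne (hp.2.1 m) (hpq m b).ne, fun m => hpq m b⟩ hZ.1)
  push Not at hqZ
  have hq' : IsInducedCopy 𝒜 q := hq.of_mem fun b => mem_of_mem_insert_of_ne (hq.2.1 b) (hqZ b)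
  by_cases hpZ : ∃ m, p m = Z
  · obtain ⟨m, rfl⟩ := hpZ
    obtain ⟨m', hm'⟩ := hM m
    have hsub : p m ∪ p m' ≤ p m :=
      hZ.2 ⟨q, hq', fun b => union_subset (hpq m b).1 (hpq m' b).1⟩ subset_union_left
    exact hm' ((hp.2.2 _ _).2 (subset_union_right.trans hsub))
  · push Not at hpZ
    exact h.1 (containsCopy_sumLex_iff.2 ⟨p, q, hp.of_mem fun m =>
      mem_of_mem_insert_of_ne (hp.2.1 m) (hpZ m), hq', hpq⟩)

/-- The part of a saturated family for `M ⊕ₗ B` consisting of the sets with no copy of `M` below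
them is saturated for `M` with a single point `T` put on top. -/
theorem IsSaturatedFamily.exists_subset_collapse_upper {M B T : Type*} [PartialOrder M]
    [PartialOrder B] [PartialOrder T] [Subsingleton T] [Nonempty T] {n : ℕ}
    {𝒜 : Finset (Finset (Fin n))} (h : IsSaturatedFamily (M ⊕ₗ B) 𝒜)
    (hM : ∀ m : M, ∃ m', ¬ m' ≤ m) :
    ∃ 𝒢 ⊆ 𝒜, IsSaturatedFamily (M ⊕ₗ T) 𝒢 := by
  classical
  obtain ⟨𝒢, h𝒢⟩ : ∃ 𝒢 : Finset (Finset (Fin n)),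
      ∀ X, X ∈ 𝒢 ↔ X ∈ 𝒜 ∧ ¬ HasCopyBelow M 𝒜 X :=
    ⟨𝒜.filter fun X => ¬ HasCopyBelow M 𝒜 X, fun X => mem_filter⟩
  have hsub : 𝒢 ⊆ 𝒜 := fun X hX => ((h𝒢 X).1 hX).1
  refine ⟨𝒢, hsub, fun hc => ?_, fun S hS => ?_⟩
  · obtain ⟨p, q, hp, hq, hpq⟩ := containsCopy_sumLex_iff.1 hc
    obtain ⟨t⟩ := ‹Nonempty T›
    exact ((h𝒢 (q t)).1 (hq.2.1 t)).2 ⟨p, hp.of_mem fun m => hsub (hp.2.1 m), fun m => hpq m t⟩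
  rw [containsCopy_sumLex_iff]
  by_cases hbelow : HasCopyBelow M 𝒜 S
  · obtain ⟨p, hp, hlt⟩ := hbelow.filter h𝒢
    exact ⟨p, fun _ => S, hp.of_mem fun m => mem_insert_of_mem (hp.2.1 m),
      isInducedCopy_const (mem_insert_self _ _), fun m _ => hlt m⟩
  have hS𝒜 : S ∉ 𝒜 := fun hc => hS ((h𝒢 S).2 ⟨hc, hbelow⟩)
  obtain ⟨p, q, hp, hq, hpq⟩ := containsCopy_sumLex_iff.1 (h.2 S hS𝒜)
  have hqS : ∀ b, q b ≠ S := by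
    rintro b rfl
    exact hbelow ⟨p, hp.of_mem fun m =>
      mem_of_mem_insert_of_ne (hp.2.1 m) (hpq m b).ne, fun m => hpq m b⟩
  have habove : HasCopyAbove B 𝒜 (univ.filter fun x => ∃ m, x ∈ p m) :=
    ⟨q, hq.of_mem fun b => mem_of_mem_insert_of_ne (hq.2.1 b) (hqS b), fun b x hx => by
      obtain ⟨m, hm⟩ := (mem_filter.1 hx).2
      exact (hpq m b).1 hm⟩
  obtain ⟨Z, hle, hZ⟩ := (Set.toFinite {X | HasCopyAbove B 𝒜 X}).exists_le_maximal habove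
  have hpZ : ∀ m, p m ⊆ Z := fun m x hx => hle (mem_filter.2 ⟨mem_univ _, m, hx⟩)
  have hpZ' : ∀ m, p m ⊂ Z := fun m => (hpZ m).ssubset_of_ne <| by
    rintro rfl
    obtain ⟨m', hm'⟩ := hM m
    exact hm' ((hp.2.2 _ _).2 (hpZ m'))
  have hZbelow : ¬ HasCopyBelow M 𝒜 Z :=
    fun hc => h.1 (containsCopy_sumLex_of_below_above hc hZ.1)
  have hZ𝒢 : Z ∈ 𝒢 := (h𝒢 Z).2 ⟨h.mem_of_maximal hM hZ, hZbelow⟩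
  refine ⟨p, fun _ => Z, hp.of_mem fun m => ?_, isInducedCopy_const (mem_insert_of_mem hZ𝒢),
    fun m _ => hpZ' m⟩
  rcases mem_insert.1 (hp.2.1 m) with hm | hm
  · exact hm ▸ mem_insert_self _ _
  · exact mem_insert_of_mem ((h𝒢 _).2 ⟨hm, fun hc => hZbelow (hc.mono (hpZ m))⟩)

/-- The order dual of `IsSaturatedFamily.exists_subset_collapse_upper`. -/
theorem IsSaturatedFamily.exists_card_le_collapse_lower {M B T : Type*} [PartialOrder M]
    [PartialOrder B] [PartialOrder T] [Subsingleton T] [Nonempty T] {n : ℕ}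
    {𝒜 : Finset (Finset (Fin n))} (h : IsSaturatedFamily (B ⊕ₗ M) 𝒜)
    (hM : ∀ m : M, ∃ m', ¬ m ≤ m') :
    ∃ 𝒢 : Finset (Finset (Fin n)), #𝒢 ≤ #𝒜 ∧ IsSaturatedFamily (T ⊕ₗ M) 𝒢 := by
  have : Subsingleton Tᵒᵈ := ‹Subsingleton T›
  obtain ⟨𝒢, hsub, h𝒢⟩ := (h.dual_compl.congr
    (OrderIso.sumLexDualAntidistrib B M)).exists_subset_collapse_upper (T := Tᵒᵈ) hM
  refine ⟨𝒢.image compl, card_image_le.trans ((card_le_card hsub).trans card_image_le), ?_⟩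
  exact (h𝒢.congr (OrderIso.sumLexDualAntidistrib T M).symm).dual_compl.congr
    (OrderIso.dualDual _).symm

theorem exists_isSaturatedFamily (α : Type*) [PartialOrder α] [Nonempty α] (n : ℕ) :
    ∃ 𝒜 : Finset (Finset (Fin n)), IsSaturatedFamily α 𝒜 := by
  obtain ⟨a⟩ := ‹Nonempty α›
  have hempty : ¬ ContainsCopy α (∅ : Finset (Finset (Fin n))) :=
    fun ⟨f, hf⟩ => notMem_empty _ (hf.2.1 a)
  obtain ⟨𝒜, -, h𝒜⟩ := (Set.toFinite
    {𝒜 : Finset (Finset (Fin n)) | ¬ ContainsCopy α 𝒜}).exists_le_maximal hempty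
  refine ⟨𝒜, h𝒜.1, fun S hS => by_contra fun hc => hS ?_⟩
  exact h𝒜.2 hc (subset_insert S 𝒜) (mem_insert_self S 𝒜)

theorem IsSaturatedFamily.satStar_le {α : Type*} [PartialOrder α] {n : ℕ}
    {𝒜 : Finset (Finset (Fin n))} (h : IsSaturatedFamily α 𝒜) : satStar α n ≤ #𝒜 :=
  Nat.sInf_le ⟨𝒜, h, rfl⟩

theorem exists_isSaturatedFamily_card_eq_satStar (α : Type*) [PartialOrder α] [Nonempty α]
    (n : ℕ) : ∃ 𝒜 : Finset (Finset (Fin n)), IsSaturatedFamily α 𝒜 ∧ #𝒜 = satStar α n := by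
  obtain ⟨𝒜, h𝒜⟩ := exists_isSaturatedFamily α n
  exact Nat.sInf_mem (s := {k : ℕ | ∃ 𝒜 : Finset (Finset (Fin n)),
    IsSaturatedFamily α 𝒜 ∧ 𝒜.card = k}) ⟨_, 𝒜, h𝒜, rfl⟩

namespace KPoset

variable {k : ℕ} {ns : Fin k → ℕ}

/-- A complete layered poset is the ordinal sum of the layers below layer `i`, layer `i`, and the
layers above layer `i`. -/
theorem nonempty_orderIso_sumLex (ns : Fin k → ℕ) (i : Fin k) :
    Nonempty (({x : KPoset ns // x.1 < i} ⊕ₗ ({x : KPoset ns // x.1 = i} ⊕ₗ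
      {x : KPoset ns // i < x.1})) ≃o KPoset ns) := by
  let f : ({x : KPoset ns // x.1 < i} ⊕ₗ ({x : KPoset ns // x.1 = i} ⊕ₗ
      {x : KPoset ns // i < x.1})) → KPoset ns :=
    fun x => Sum.elim Subtype.val (fun y => Sum.elim Subtype.val Subtype.val (ofLex y)) (ofLex x)
  have hlt {x y : KPoset ns} (h : y.1 < x.1) : ¬ x ≤ y := by
    rintro (rfl | h')
    · exact lt_irrefl _ h
    · exact h.asymm h'
  have hf : ∀ a b, f a ≤ f b ↔ a ≤ b := by
    rintro (a | a | a) (b | b | b)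
    · exact (Sum.Lex.inl_le_inl_iff (a := a) (b := b)).symm
    · exact iff_of_true (Or.inr (a.2.trans_eq b.2.symm)) (Sum.Lex.inl_le_inr _ _)
    · exact iff_of_true (Or.inr (a.2.trans b.2)) (Sum.Lex.inl_le_inr _ _)
    · exact iff_of_false (hlt (b.2.trans_eq a.2.symm)) Sum.Lex.not_inr_le_inl
    · exact (Sum.Lex.inr_le_inr_iff.trans (Sum.Lex.inl_le_inl_iff (a := a) (b := b))).symm
    · exact iff_of_true (Or.inr (a.2.trans_lt b.2))
        (Sum.Lex.inr_le_inr_iff.2 (Sum.Lex.inl_le_inr _ _))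
    · exact iff_of_false (hlt (b.2.trans a.2)) Sum.Lex.not_inr_le_inl
    · exact iff_of_false (hlt (b.2.trans_lt a.2))
        fun h => Sum.Lex.not_inr_le_inl (Sum.Lex.inr_le_inr_iff.1 h)
    · exact (Sum.Lex.inr_le_inr_iff.trans (Sum.Lex.inr_le_inr_iff (a := a) (b := b))).symm
  have hsurj : Function.Surjective f := by
    intro x
    rcases lt_trichotomy x.1 i with h | h | h
    · exact ⟨Sum.inlₗ ⟨x, h⟩, rfl⟩
    · exact ⟨Sum.inrₗ (Sum.inlₗ ⟨x, h⟩), rfl⟩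
    · exact ⟨Sum.inrₗ (Sum.inrₗ ⟨x, h⟩), rfl⟩
  exact ⟨RelIso.ofSurjective (OrderEmbedding.ofMapLEIff f hf) hsurj⟩

theorem layer_le_iff_eq {i : Fin k} {x y : {x : KPoset ns // x.1 = i}} : x ≤ y ↔ x = y := by
  refine ⟨?_, fun h => h.le⟩
  rintro (h | h)
  · exact Subtype.ext h
  · exact absurd h (by rw [x.2, y.2]; exact lt_irrefl i)

/-- A layer has as many elements as prescribed. -/
def layerEquiv (ns : Fin k → ℕ) (i : Fin k) : {x : KPoset ns // x.1 = i} ≃ Fin (ns i) where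
  toFun x := Fin.cast (congrArg ns x.2) x.1.2
  invFun j := ⟨⟨i, j⟩, rfl⟩
  left_inv := by rintro ⟨⟨_, j⟩, rfl⟩; rfl
  right_inv _ := rfl

/-- Layers of equal size are isomorphic, since both are antichains. -/
theorem nonempty_layer_orderIso {l : ℕ} {ms : Fin l → ℕ} {i : Fin k} {j : Fin l}
    (h : ns i = ms j) :
    Nonempty ({x : KPoset ns // x.1 = i} ≃o {x : KPoset ms // x.1 = j}) :=
  ⟨{ toEquiv := (layerEquiv ns i).trans ((finCongr h).trans (layerEquiv ms j).symm)
     map_rel_iff' := by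
       intro a b
       rw [layer_le_iff_eq, layer_le_iff_eq, Equiv.apply_eq_iff_eq] }⟩

theorem exists_ne_of_two_le (x : KPoset ns) (h : 2 ≤ ns x.1) :
    ∃ y : KPoset ns, y.1 = x.1 ∧ y ≠ x := by
  obtain ⟨i, a⟩ := x
  have : Nontrivial (Fin (ns i)) := Fin.nontrivial_iff_two_le.2 h
  obtain ⟨b, hb⟩ := exists_ne a
  exact ⟨⟨i, b⟩, rfl, fun he => hb (eq_of_heq (Sigma.mk.inj he).2)⟩

theorem not_le_of_fst_eq_of_ne {x y : KPoset ns} (h : y.1 = x.1) (hne : y ≠ x) : ¬ y ≤ x := by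
  rintro (he | hlt)
  · exact hne he
  · exact hlt.ne h

end KPoset

/-- If `k ≥ 1` and `n₁, …, n_k ≥ 2` with `nᵢ = 2` for at least one `i`,
then `sat*(n, K_{n₁,…,n_k}) ≥ sat*(n, D₂)` for every `n`, where the diamond `D₂` is
`K_{1,2,1}`. -/
theorem statement18 (k : ℕ) (hk : 1 ≤ k) (ns : Fin k → ℕ)
    (hns : ∀ i, 2 ≤ ns i) (hex : ∃ i, ns i = 2) (n : ℕ) :
    satStar (KPoset ![1, 2, 1]) n ≤ satStar (KPoset ns) n := by
  obtain ⟨i, hi⟩ := hex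
  have : Nonempty (KPoset ns) := ⟨⟨i, ⟨0, by omega⟩⟩⟩
  obtain ⟨𝒜, h𝒜, hcard⟩ := exists_isSaturatedFamily_card_eq_satStar (KPoset ns) n
  obtain ⟨e⟩ := KPoset.nonempty_orderIso_sumLex ns i
  obtain ⟨d⟩ := KPoset.nonempty_orderIso_sumLex ![1, 2, 1] 1
  obtain ⟨c⟩ : Nonempty ({x : KPoset ns // x.1 = i} ≃o {x : KPoset ![1, 2, 1] // x.1 = 1}) :=
    KPoset.nonempty_layer_orderIso hi
  have hlayer (x : {x : KPoset ns // x.1 = i}) :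
      ∃ y : {x : KPoset ns // x.1 = i}, ¬ y ≤ x ∧ ¬ x ≤ y := by
    obtain ⟨y, hy, hne⟩ := KPoset.exists_ne_of_two_le x.1 (hns _)
    exact ⟨⟨y, hy.trans x.2⟩, KPoset.not_le_of_fst_eq_of_ne hy hne,
      KPoset.not_le_of_fst_eq_of_ne hy.symm hne.symm⟩
  obtain ⟨x₀⟩ : Nonempty {x : KPoset ns // x.1 = i} := ⟨⟨⟨i, ⟨0, by omega⟩⟩, rfl⟩⟩
  have hbot : Subsingleton {x : KPoset ![1, 2, 1] // x.1 < 1} := by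
    refine ⟨?_⟩
    rintro ⟨⟨a, p⟩, ha⟩ ⟨⟨b, q⟩, hb⟩
    obtain rfl : a = 0 := by simpa using ha
    obtain rfl : b = 0 := by simpa using hb
    have : p = q := Subsingleton.elim (α := Fin 1) p q
    rw [this]
  have htwo : ∀ a : Fin 3, 1 < a → a = 2 := by decide
  have htop : Subsingleton {x : KPoset ![1, 2, 1] // 1 < x.1} := by
    refine ⟨?_⟩
    rintro ⟨⟨a, p⟩, ha⟩ ⟨⟨b, q⟩, hb⟩
    obtain rfl : a = 2 := htwo a ha
    obtain rfl : b = 2 := htwo b hb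
    have : p = q := Subsingleton.elim (α := Fin 1) p q
    rw [this]
  have : Nonempty {x : KPoset ![1, 2, 1] // x.1 < 1} :=
    ⟨⟨⟨0, (0 : Fin 1)⟩, Fin.zero_lt_one⟩⟩
  have : Nonempty {x : KPoset ![1, 2, 1] // 1 < x.1} :=
    ⟨⟨⟨2, (0 : Fin 1)⟩, by decide⟩⟩
  obtain ⟨ℬ, hℬ𝒜, hℬ⟩ := (h𝒜.congr (e.symm.trans
    (OrderIso.sumLexAssoc _ _ _).symm)).exists_subset_collapse_upper
    (T := {x : KPoset ![1, 2, 1] // 1 < x.1}) <| by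
      rintro (a | x)
      · exact ⟨Sum.inrₗ x₀, Sum.Lex.not_inr_le_inl⟩
      · obtain ⟨y, hy, -⟩ := hlayer x
        exact ⟨Sum.inrₗ y, fun h => hy (Sum.Lex.inr_le_inr_iff.1 h)⟩
  obtain ⟨𝒞, h𝒞ℬ, h𝒞⟩ := (hℬ.congr (OrderIso.sumLexAssoc _ _ _)).exists_card_le_collapse_lower
    (T := {x : KPoset ![1, 2, 1] // x.1 < 1}) <| by
      rintro (x | b)
      · obtain ⟨y, -, hy⟩ := hlayer x
        exact ⟨Sum.inlₗ y, fun h => hy (Sum.Lex.inl_le_inl_iff.1 h)⟩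
      · exact ⟨Sum.inlₗ x₀, Sum.Lex.not_inr_le_inl⟩
  have hD := h𝒞.congr (((OrderIso.refl _).sumLexCongr (c.sumLexCongr (OrderIso.refl _))).trans d)
  exact hD.satStar_le.trans (h𝒞ℬ.trans ((card_le_card hℬ𝒜).trans hcard.le))
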